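/- Let A and B be C*-algebras, let C be a C*-algebra of stable rank 1, and let φ, ψ : A ⊕ B → C be *-homomorphisms such that the restriction of φ to A is approximately unitarily equivalent to the restriction of ψ to A, and the restriction of φ to B is approximately unitarily equivalent to the restriction of ψ to B. Then φ is approximately unitarily equivalent to ψ. -/

import Mathlib

/-- Two maps into a C*-algebra `C` are approximately unitarily equivalent (via
unitaries in the minimal unitization `C~`). -/
def ApproxUnitarilyEquiv {A C : Type*} [NonUnitalCStarAlgebra C]
    (φ ψ : A → C) : Prop :=
  ∀ (F : Finset A) (ε : ℝ), 0 < ε →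
    ∃ u ∈ unitary (Unitization ℂ C),
      ∀ x ∈ F, ‖star u * (φ x : Unitization ℂ C) * u - (ψ x : Unitization ℂ C)‖ < ε

/-- A C*-algebra has stable rank one if the invertible elements of its minimal
unitization are dense. -/
def StableRankOne (C : Type*) [NonUnitalCStarAlgebra C] : Prop :=
  Dense {x : Unitization ℂ C | IsUnit x}

section CStarAlgebra

variable {D : Type*} [CStarAlgebra D]

/-- The unitary part `w` of the polar decomposition of an invertible element `y` satisfies
`w * z ≈ y * z` wherever `star y * y * z ≈ z`. -/
lemma exists_unitary_norm_mul_sub_mul_le {y : D} (hy : IsUnit y) :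
    ∃ w ∈ unitary D, ∀ z : D, ‖w * z - y * z‖ ≤ ‖star y * y * z - z‖ := by
  let _ := CStarAlgebra.spectralOrder D
  let _ := CStarAlgebra.spectralOrderedRing D
  set h : D := CFC.abs y
  have h_nonneg : 0 ≤ h := CFC.abs_nonneg y
  have h_star : star h = h := (IsSelfAdjoint.of_nonneg h_nonneg).star_eq
  have h_mul : h * h = star y * y := CFC.abs_mul_abs y
  have h_unit : IsUnit h :=
    (CFC.isUnit_sqrt_iff (star y * y) (star_mul_self_nonneg y)).2 (hy.star.mul hy)
  obtain ⟨g, hg⟩ := h_unit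
  have g_star : star (↑g⁻¹ : D) = ↑g⁻¹ := by
    have hgs : star g = g := Units.ext (by simp [hg, h_star])
    rw [← Units.coe_star_inv, hgs]
  set k : D := ↑g⁻¹ with hk
  have hkh : k * h = 1 := by rw [hk, ← hg, Units.inv_mul]
  have hhk : h * k = 1 := by rw [hk, ← hg, Units.mul_inv]
  have w_star_mul : star (y * k) * (y * k) = 1 := by
    rw [star_mul, g_star, mul_assoc, ← mul_assoc (star y), ← h_mul, mul_assoc h, hhk, mul_one, hkh]
  have w_unit : IsUnit (y * k) := hy.mul (Units.isUnit _)
  have w_mem : y * k ∈ unitary D := w_unit.mem_unitary_of_star_mul_self w_star_mul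
  refine ⟨y * k, w_mem, fun z ↦ ?_⟩
  have key : y * k * z - y * z = -(y * k * ((h - 1) * z)) := by
    have : y * k * (h * z) = y * z := by
      rw [mul_assoc, ← mul_assoc k, hkh, one_mul]
    rw [sub_mul, one_mul, mul_sub, this, neg_sub]
  rw [key, norm_neg, CStarRing.norm_mem_unitary_mul _ w_mem]
  set s : D := (h - 1) * z with hs
  have hs' : star y * y * z - z = (h + 1) * s := by
    rw [hs, ← h_mul]; noncomm_ring
  rw [hs']
  have hle : star s * s ≤ star ((h + 1) * s) * ((h + 1) * s) := by
    have h1 : star ((h + 1) * s) * ((h + 1) * s) =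
        star s * s + (star s * (h * h + h + h) * s) := by
      rw [star_mul, star_add, star_one, h_star]; noncomm_ring
    rw [h1]
    refine le_add_of_nonneg_right (star_left_conjugate_nonneg ?_ s)
    have : 0 ≤ h * h := by rw [h_mul]; exact star_mul_self_nonneg y
    positivity
  have hnorm := CStarAlgebra.norm_le_norm_of_nonneg_of_le (star_mul_self_nonneg s) hle
  rw [CStarRing.norm_star_mul_self, CStarRing.norm_star_mul_self] at hnorm
  exact (mul_self_le_mul_self_iff (norm_nonneg _) (norm_nonneg _)).2 hnorm

lemma norm_mul_le_of_norm_left_le_one {a b : D} {r : ℝ} (ha : ‖a‖ ≤ 1) (hb : ‖b‖ ≤ r) :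
    ‖a * b‖ ≤ r :=
  (norm_mul_le a b).trans <|
    (mul_le_of_le_one_left (norm_nonneg b) ha).trans hb

lemma norm_le_one_of_mem_unitary {u : D} (hu : u ∈ unitary D) : ‖u‖ ≤ 1 := by
  nontriviality D
  exact (CStarRing.norm_of_mem_unitary hu).le

/-- If unitaries `u`, `v` approximately intertwine the contractions `P`, `p` and `Q`, `q`, and
`y` is close to `P * u * p + Q * v * q`, then `y` is approximately isometric, and close to `u`,
on elements `z` on which `p` acts approximately as the identity and which `q` annihilates. -/
lemma norm_mul_sub_mul_le_and_norm_star_mul_self_mul_sub_le {P Q p q u v y z : D} {δ M : ℝ}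
    (hu : u ∈ unitary D) (hv : v ∈ unitary D)
    (hPs : star P = P) (hQs : star Q = Q) (hps : star p = p) (hqs : star q = q)
    (hP : ‖P‖ ≤ 1) (hQ : ‖Q‖ ≤ 1) (hp : ‖p‖ ≤ 1) (hq : ‖q‖ ≤ 1) (hQP : Q * P = 0)
    (hPu : ‖P * u - u * p‖ ≤ δ) (hδ : δ ≤ 1)
    (hy : ‖y - (P * u * p + Q * v * q)‖ ≤ δ)
    (hz : ‖z‖ ≤ M) (hpz : ‖p * z - z‖ ≤ δ) (hqz : q * z = 0) :
    ‖y * z - u * z‖ ≤ 2 * (M + 1) * δ ∧ ‖star y * y * z - z‖ ≤ 9 * (M + 1) * δ := by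
  have hδ0 : 0 ≤ δ := (norm_nonneg _).trans hPu
  have hM0 : 0 ≤ M := (norm_nonneg _).trans hz
  have hu1 := norm_le_one_of_mem_unitary hu
  have hv1 := norm_le_one_of_mem_unitary hv
  have hus1 : ‖star u‖ ≤ 1 := (norm_star u).trans_le hu1
  have hvs1 : ‖star v‖ ≤ 1 := (norm_star v).trans_le hv1
  have huu : star u * u = 1 := Unitary.star_mul_self_of_mem hu
  set x : D := P * u * p + Q * v * q with hx
  have hPuz : ‖(P * u - u * p) * z‖ ≤ δ * M := norm_mul_le_of_le hPu hz
  have hyz : ‖(y - x) * z‖ ≤ δ * M := norm_mul_le_of_le hy hz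
  have hyuz : ‖star (y - x) * (u * z)‖ ≤ δ * M :=
    norm_mul_le_of_le ((norm_star _).trans_le hy) (norm_mul_le_of_norm_left_le_one hu1 hz)
  have hQuz : ‖Q * (u * z)‖ ≤ δ * M + δ := by
    have : Q * (u * z) = -(Q * ((P * u - u * p) * z)) - Q * (u * (p * z - z)) := by
      have h0 : Q * (P * u * z) = 0 := by rw [← mul_assoc, ← mul_assoc, hQP]; simp
      rw [sub_mul, mul_sub Q, h0]; noncomm_ring
    rw [this]
    refine norm_sub_le_of_le ?_ ?_
    · rw [norm_neg]; exact norm_mul_le_of_norm_left_le_one hQ hPuz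
    · exact norm_mul_le_of_norm_left_le_one hQ (norm_mul_le_of_norm_left_le_one hu1 hpz)
  have hxz : ‖y * z - u * z‖ ≤ 2 * (M + 1) * δ := by
    have : y * z - u * z = (y - x) * z + P * (u * (p * z - z)) + (P * u - u * p) * z
        + u * (p * z - z) := by
      have h0 : Q * v * q * z = 0 := by rw [mul_assoc, hqz, mul_zero]
      rw [hx, sub_mul, add_mul, h0]; noncomm_ring
    rw [this]
    refine (norm_add_le_of_le (norm_add_le_of_le (norm_add_le_of_le hyz (norm_mul_le_of_norm_left_le_one hP
      (norm_mul_le_of_norm_left_le_one hu1 hpz))) hPuz)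
      (norm_mul_le_of_norm_left_le_one hu1 hpz)).trans (by linarith)
  have hxs : star x = p * star u * P + q * star v * Q := by
    simp only [hx, star_add, star_mul, hPs, hQs, hps, hqs, mul_assoc]
  have hxuz : ‖star y * (u * z) - z‖ ≤ 3 * (M + 1) * δ := by
    have : star y * (u * z) - z = (star (y - x) * (u * z) + q * (star v * (Q * (u * z)))) +
        (p * (star u * ((P * u - u * p) * z)) + p * (p * z - z) + (p * z - z)) := by
      have h0 : p * (star u * (u * p * z)) = p * (p * z) := by
        rw [mul_assoc u, ← mul_assoc (star u), huu, one_mul]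
      rw [star_sub, hxs, sub_mul (P * u), mul_sub (star u), mul_sub p, h0]; noncomm_ring
    rw [this]
    refine (norm_add_le_of_le (norm_add_le_of_le hyuz
      (norm_mul_le_of_norm_left_le_one hq (norm_mul_le_of_norm_left_le_one hvs1 hQuz)))
      (norm_add_le_of_le (norm_add_le_of_le (norm_mul_le_of_norm_left_le_one hp
        (norm_mul_le_of_norm_left_le_one hus1 hPuz))
        (norm_mul_le_of_norm_left_le_one hp hpz)) hpz)).trans (by linarith)
  have hyn : ‖star y‖ ≤ 3 := by
    have h1 : ‖x‖ ≤ 1 + 1 := by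
      rw [hx, mul_assoc, mul_assoc]
      exact norm_add_le_of_le
        (norm_mul_le_of_norm_left_le_one hP (norm_mul_le_of_norm_left_le_one hu1 hp))
        (norm_mul_le_of_norm_left_le_one hQ (norm_mul_le_of_norm_left_le_one hv1 hq))
    have h2 := norm_add_le_of_le hy h1
    rw [sub_add_cancel] at h2
    rw [norm_star]; linarith
  refine ⟨hxz, ?_⟩
  have : star y * y * z - z = star y * (y * z - u * z) + (star y * (u * z) - z) := by
    noncomm_ring
  rw [this]
  refine (norm_add_le_of_le (norm_mul_le_of_le hyn hxz) hxuz).trans (by linarith)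

lemma norm_conj_sub_conj_le {u w z : D} {r : ℝ} (hu : u ∈ unitary D) (hw : w ∈ unitary D)
    (h : ‖w * z - u * z‖ ≤ r) (h' : ‖w * star z - u * star z‖ ≤ r) :
    ‖w * z * star w - u * z * star u‖ ≤ 2 * r := by
  have : w * z * star w - u * z * star u =
      (w * z - u * z) * star w + u * star (w * star z - u * star z) := by
    simp only [star_sub, star_mul, star_star]; noncomm_ring
  rw [this, two_mul]
  refine norm_add_le_of_le ?_ ?_
  · rwa [CStarRing.norm_mul_mem_unitary _ (Unitary.star_mem hw)]
  · rwa [CStarRing.norm_mem_unitary_mul _ hu, norm_star]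

lemma norm_conj_sub_eq {u x z : D} (hu : u ∈ unitary D) :
    ‖star u * x * u - z‖ = ‖u * z * star u - x‖ := by
  have h1 : star u * u = 1 := Unitary.star_mul_self_of_mem hu
  have h : star u * x * u - z = -(star u * (u * z * star u - x) * u) := by
    have : star u * (u * z * star u) * u = z := by
      simp only [mul_assoc, h1, mul_one]; rw [← mul_assoc, h1, one_mul]
    rw [mul_sub, sub_mul, this, neg_sub]
  rw [h, norm_neg, CStarRing.norm_mul_mem_unitary _ hu,
    CStarRing.norm_mem_unitary_mul _ (Unitary.star_mem hu)]

/-- The unitary part `w` of an element `y` close to `P * u * p + Q * v * q` implements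
approximately the same conjugation as `u` on elements on which `p` acts approximately as the
identity and which `q` annihilates. -/
lemma norm_conj_sub_le {P Q p q u v y w x z : D} {δ M : ℝ}
    (hu : u ∈ unitary D) (hv : v ∈ unitary D) (hw : w ∈ unitary D)
    (hwy : ∀ z : D, ‖w * z - y * z‖ ≤ ‖star y * y * z - z‖)
    (hPs : star P = P) (hQs : star Q = Q) (hps : star p = p) (hqs : star q = q)
    (hP : ‖P‖ ≤ 1) (hQ : ‖Q‖ ≤ 1) (hp : ‖p‖ ≤ 1) (hq : ‖q‖ ≤ 1) (hQP : Q * P = 0)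
    (hPu : ‖star u * P * u - p‖ ≤ δ) (hδ : δ ≤ 1)
    (hy : ‖y - (P * u * p + Q * v * q)‖ ≤ δ)
    (hz : ‖z‖ ≤ M) (hpz : ‖p * z - z‖ ≤ δ) (hpz' : ‖p * star z - star z‖ ≤ δ)
    (hqz : q * z = 0) (hqz' : q * star z = 0) (hx : ‖star u * x * u - z‖ ≤ δ) :
    ‖star w * x * w - z‖ ≤ 23 * (M + 1) * δ := by
  have hδ0 : 0 ≤ δ := (norm_nonneg _).trans hPu
  have hM0 : 0 ≤ M := (norm_nonneg _).trans hz
  have hPu' : ‖P * u - u * p‖ ≤ δ := by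
    rwa [← CStarRing.norm_mem_unitary_mul _ (Unitary.star_mem hu), mul_sub, ← mul_assoc,
      ← mul_assoc, Unitary.star_mul_self_of_mem hu, one_mul]
  have close {t : D} (ht : ‖t‖ ≤ M) (hpt : ‖p * t - t‖ ≤ δ) (hqt : q * t = 0) :
      ‖w * t - u * t‖ ≤ 11 * (M + 1) * δ := by
    obtain ⟨h1, h2⟩ := norm_mul_sub_mul_le_and_norm_star_mul_self_mul_sub_le hu hv hPs hQs hps hqs
      hP hQ hp hq hQP hPu' hδ hy ht hpt hqt
    have := norm_sub_le_norm_sub_add_norm_sub (w * t) (y * t) (u * t)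
    linarith [hwy t]
  have hconj := norm_conj_sub_conj_le hu hw (close hz hpz hqz)
    (close ((norm_star z).trans_le hz) hpz' hqz')
  rw [norm_conj_sub_eq hu] at hx
  rw [norm_conj_sub_eq hw]
  have := norm_sub_le_norm_sub_add_norm_sub (w * z * star w) (u * z * star u) x
  nlinarith [mul_nonneg hM0 hδ0]

end CStarAlgebra

/-- Finite subsets of a C⋆-algebra admit approximately neutral self-adjoint contractions. -/
lemma exists_isSelfAdjoint_norm_mul_sub_lt {A : Type*} [NonUnitalCStarAlgebra A]
    (F : Finset A) {δ : ℝ} (hδ : 0 < δ) :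
    ∃ e : A, star e = e ∧ ‖e‖ ≤ 1 ∧ ∀ a ∈ F, ‖e * a - a‖ < δ ∧ ‖e * star a - star a‖ < δ := by
  let _ := CStarAlgebra.spectralOrder A
  let _ := CStarAlgebra.spectralOrderedRing A
  have hl := CStarAlgebra.increasingApproximateUnit A
  have hev (a : A) : ∀ᶠ e in CStarAlgebra.approximateUnit A, ‖e * a - a‖ < δ := by
    have := Metric.tendsto_nhds.1 (hl.tendsto_mul_right a) δ hδ
    simpa only [dist_eq_norm] using this
  have hF := (Filter.eventually_all_finset F).2 fun a _ ↦ (hev a).and (hev (star a))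
  obtain ⟨e, ⟨h1, h2⟩, h3⟩ := ((hl.eventually_star_eq.and hl.eventually_norm).and hF).exists
  exact ⟨e, h1, h2, h3⟩

/-- If `φ, ψ : A ⊕ B → C` are ∗-homomorphisms into a stable rank one C*-algebra whose
restrictions to `A` and to `B` are approximately unitarily equivalent, then `φ` and `ψ`
are approximately unitarily equivalent. -/
theorem approxUnitarilyEquiv_of_restrictions
    {A B C : Type*} [NonUnitalCStarAlgebra A] [NonUnitalCStarAlgebra B]
    [NonUnitalCStarAlgebra C]
    (hC : StableRankOne C)
    (φ ψ : (A × B) →⋆ₙₐ[ℂ] C)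
    (hA : ApproxUnitarilyEquiv (fun a : A => φ (a, 0)) (fun a : A => ψ (a, 0)))
    (hB : ApproxUnitarilyEquiv (fun b : B => φ (0, b)) (fun b : B => ψ (0, b))) :
    ApproxUnitarilyEquiv (⇑φ) (⇑ψ) := by
  classical
  intro F ε hε
  let Φ : (A × B) →⋆ₙₐ[ℂ] Unitization ℂ C := (Unitization.inrNonUnitalStarAlgHom ℂ C).comp φ
  let Ψ : (A × B) →⋆ₙₐ[ℂ] Unitization ℂ C := (Unitization.inrNonUnitalStarAlgHom ℂ C).comp ψ
  have norm_le (Θ : (A × B) →⋆ₙₐ[ℂ] Unitization ℂ C) (x : A × B) : ‖Θ x‖ ≤ ‖x‖ :=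
    NonUnitalStarAlgHom.norm_apply_le Θ x
  obtain ⟨M, hM0, hM⟩ : ∃ M : ℝ, 0 ≤ M ∧ ∀ x ∈ F, ‖x‖ ≤ M :=
    ⟨∑ x ∈ F, ‖x‖, Finset.sum_nonneg fun _ _ ↦ norm_nonneg _,
      fun x hx ↦ Finset.single_le_sum (f := fun x ↦ ‖x‖) (fun _ _ ↦ norm_nonneg _) hx⟩
  obtain ⟨δ, hδ0, hδ1, hδε⟩ : ∃ δ : ℝ, 0 < δ ∧ δ ≤ 1 ∧ 46 * (M + 1) * δ < ε := by
    have hK : 0 < 46 * (M + 1) := by positivity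
    refine ⟨min 1 (ε / (46 * (M + 1)) / 2), by positivity, min_le_left _ _, ?_⟩
    calc 46 * (M + 1) * min 1 (ε / (46 * (M + 1)) / 2)
        ≤ 46 * (M + 1) * (ε / (46 * (M + 1)) / 2) := by gcongr; exact min_le_right _ _
      _ = ε / 2 := by field_simp
      _ < ε := half_lt_self hε
  obtain ⟨e, he_star, he_norm, he⟩ := exists_isSelfAdjoint_norm_mul_sub_lt (F.image Prod.fst) hδ0
  obtain ⟨f, hf_star, hf_norm, hf⟩ := exists_isSelfAdjoint_norm_mul_sub_lt (F.image Prod.snd) hδ0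
  obtain ⟨u, hu, hu'⟩ := hA (insert e (F.image Prod.fst)) δ hδ0
  obtain ⟨v, hv, hv'⟩ := hB (insert f (F.image Prod.snd)) δ hδ0
  replace hu' : ∀ a ∈ insert e (F.image Prod.fst), ‖star u * Φ (a, 0) * u - Ψ (a, 0)‖ < δ := hu'
  replace hv' : ∀ b ∈ insert f (F.image Prod.snd), ‖star v * Φ (0, b) * v - Ψ (0, b)‖ < δ := hv'
  obtain ⟨y, hy, hxy⟩ := Metric.dense_iff.1 hC
    (Φ (e, 0) * u * Ψ (e, 0) + Φ (0, f) * v * Ψ (0, f)) δ hδ0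
  rw [Metric.mem_ball, dist_eq_norm] at hy
  obtain ⟨w, hw, hwy⟩ := exists_unitary_norm_mul_sub_mul_le hxy
  refine ⟨w, hw, fun x hx ↦ ?_⟩
  obtain ⟨a, b⟩ := x
  change ‖star w * Φ (a, b) * w - Ψ (a, b)‖ < ε
  have ha : a ∈ F.image Prod.fst := Finset.mem_image_of_mem Prod.fst hx
  have hb : b ∈ F.image Prod.snd := Finset.mem_image_of_mem Prod.snd hx
  have he_star' (Θ : (A × B) →⋆ₙₐ[ℂ] Unitization ℂ C) : star (Θ (e, 0)) = Θ (e, 0) := by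
    rw [← map_star, Prod.star_def, he_star, star_zero]
  have hf_star' (Θ : (A × B) →⋆ₙₐ[ℂ] Unitization ℂ C) : star (Θ (0, f)) = Θ (0, f) := by
    rw [← map_star, Prod.star_def, hf_star, star_zero]
  have he_norm' (Θ : (A × B) →⋆ₙₐ[ℂ] Unitization ℂ C) : ‖Θ (e, 0)‖ ≤ 1 :=
    (norm_le Θ _).trans (by simpa [Prod.norm_def] using he_norm)
  have hf_norm' (Θ : (A × B) →⋆ₙₐ[ℂ] Unitization ℂ C) : ‖Θ (0, f)‖ ≤ 1 :=
    (norm_le Θ _).trans (by simpa [Prod.norm_def] using hf_norm)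
  have mul_fst_snd (Θ : (A × B) →⋆ₙₐ[ℂ] Unitization ℂ C) (a : A) (b : B) :
      Θ (a, 0) * Θ (0, b) = 0 := by
    rw [← map_mul, Prod.mk_mul_mk, zero_mul, mul_zero, Prod.mk_zero_zero, map_zero]
  have mul_snd_fst (Θ : (A × B) →⋆ₙₐ[ℂ] Unitization ℂ C) (a : A) (b : B) :
      Θ (0, b) * Θ (a, 0) = 0 := by
    rw [← map_mul, Prod.mk_mul_mk, zero_mul, mul_zero, Prod.mk_zero_zero, map_zero]
  have star_fst (a : A) : star (Ψ (a, 0)) = Ψ (star a, 0) := by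
    rw [← map_star, Prod.star_def, star_zero]
  have star_snd (b : B) : star (Ψ (0, b)) = Ψ (0, star b) := by
    rw [← map_star, Prod.star_def, star_zero]
  have unit_fst (c : A) (hc : ‖e * c - c‖ < δ) : ‖Ψ (e, 0) * Ψ (c, 0) - Ψ (c, 0)‖ ≤ δ := by
    rw [← map_mul, ← map_sub]
    exact (norm_le Ψ _).trans (by simpa [Prod.norm_def, hδ0.le] using hc.le)
  have unit_snd (c : B) (hc : ‖f * c - c‖ < δ) : ‖Ψ (0, f) * Ψ (0, c) - Ψ (0, c)‖ ≤ δ := by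
    rw [← map_mul, ← map_sub]
    exact (norm_le Ψ _).trans (by simpa [Prod.norm_def, hδ0.le] using hc.le)
  have norm_a : ‖Ψ (a, 0)‖ ≤ M := (norm_le Ψ _).trans <|
    le_trans (by simp [Prod.norm_def]) (hM _ hx)
  have norm_b : ‖Ψ (0, b)‖ ≤ M := (norm_le Ψ _).trans <|
    le_trans (by simp [Prod.norm_def]) (hM _ hx)
  have conj_fst : ‖star w * Φ (a, 0) * w - Ψ (a, 0)‖ ≤ 23 * (M + 1) * δ :=
    norm_conj_sub_le hu hv hw hwy (he_star' Φ) (hf_star' Φ) (he_star' Ψ) (hf_star' Ψ)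
      (he_norm' Φ) (hf_norm' Φ) (he_norm' Ψ) (hf_norm' Ψ) (mul_snd_fst Φ e f)
      (hu' e (Finset.mem_insert_self _ _)).le hδ1 hy.le norm_a (unit_fst a (he a ha).1)
      (star_fst a ▸ unit_fst _ (he a ha).2) (mul_snd_fst Ψ a f)
      (star_fst a ▸ mul_snd_fst Ψ _ f) (hu' a (Finset.mem_insert_of_mem ha)).le
  have conj_snd : ‖star w * Φ (0, b) * w - Ψ (0, b)‖ ≤ 23 * (M + 1) * δ :=
    norm_conj_sub_le hv hu hw hwy (hf_star' Φ) (he_star' Φ) (hf_star' Ψ) (he_star' Ψ)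
      (hf_norm' Φ) (he_norm' Φ) (hf_norm' Ψ) (he_norm' Ψ) (mul_fst_snd Φ e f)
      (hv' f (Finset.mem_insert_self _ _)).le hδ1 (by rw [add_comm]; exact hy.le) norm_b
      (unit_snd b (hf b hb).1) (star_snd b ▸ unit_snd _ (hf b hb).2) (mul_fst_snd Ψ e b)
      (star_snd b ▸ mul_fst_snd Ψ e _) (hv' b (Finset.mem_insert_of_mem hb)).le
  have split (Θ : (A × B) →⋆ₙₐ[ℂ] Unitization ℂ C) : Θ (a, b) = Θ (a, 0) + Θ (0, b) := by
    rw [← map_add, Prod.mk_add_mk, add_zero, zero_add]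
  rw [split Φ, split Ψ, mul_add, add_mul, add_sub_add_comm]
  exact (norm_add_le_of_le conj_fst conj_snd).trans_lt (by linarith)
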